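/- Let f be a field of characteristic zero generated (over its prime field ℚ) by a finite set S. Then the set π(t(f*)) of primes p such that f* contains an element of order p is finite, the field f is regular, and f* = T × F where T is a finite group and F is a free abelian group. -/

import Mathlib

/-- A field `k` is regular if it is countable and its multiplicative group is a direct
product of a torsion group and a free abelian group. -/
def IsRegularField (k : Type*) [Field k] : Prop :=
  Countable k ∧
    ∃ T Fr : Subgroup kˣ, (∀ x ∈ T, IsOfFinOrder x) ∧ Module.Free ℤ (Additive Fr) ∧
      T ⊓ Fr = ⊥ ∧ T ⊔ Fr = ⊤

universe u

theorem Submodule.free_of_finsupp {R ι : Type*} [CommRing R] [IsDomain R]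
    [IsPrincipalIdealRing R] (N : Submodule R (ι →₀ R)) : Module.Free R N := by
  classical
  obtain ⟨_, _⟩ := exists_wellFoundedLT ι
  let N' : ι → Submodule R (ι →₀ R) := fun i ↦ N ⊓ Finsupp.supported R R (Set.Iic i)
  let J : ι → Ideal R := fun i ↦ (N' i).map (Finsupp.lapply i)
  let a : ι → R := fun i ↦ Submodule.IsPrincipal.generator (J i)
  have hg : ∀ i, ∃ g ∈ N' i, g i = a i := fun i ↦
    Submodule.mem_map.1 (Submodule.IsPrincipal.generator_mem (J i))
  choose g hgN hga using hg
  have hgi : ∀ i j, i < j → g i j = 0 := fun i j hij ↦ by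
    by_contra h
    exact absurd ((Finsupp.mem_supported R _).1 (hgN i).2 (Finsupp.mem_support_iff.2 h))
      (not_le.2 hij)
  let b : {i // a i ≠ 0} → N := fun i ↦ ⟨g i, (hgN i).1⟩
  have hli : LinearIndependent R b := by
    refine (injective_iff_map_eq_zero (Finsupp.linearCombination R b)).2 fun c hc ↦ ?_
    by_contra hne
    obtain ⟨m, hm, hmax⟩ := c.support.exists_max_image id (Finsupp.support_nonempty_iff.2 hne)
    have h : ((Finsupp.linearCombination R b c : N) : ι →₀ R) m = c m * a m := by
      rw [Finsupp.linearCombination_apply, Finsupp.sum, Submodule.coe_sum, Finsupp.finsetSum_apply,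
        Finset.sum_eq_single m]
      · simp [b, hga]
      · intro i hi him
        have : (i : ι) < m := lt_of_le_of_ne (hmax i hi) (fun h ↦ him (Subtype.ext h))
        simp [b, hgi _ _ this]
      · intro h
        exact absurd hm h
    rw [hc] at h
    exact mul_ne_zero (Finsupp.mem_support_iff.1 hm) m.2 (by simpa using h.symm)
  have hspan : ∀ (i : ι) (x : N), (x : ι →₀ R) ∈ Finsupp.supported R R (Set.Iic i) →
      x ∈ Submodule.span R (Set.range b) := by
    intro i
    induction i using WellFoundedLT.induction with
    | ind i ih =>
    have lower : ∀ x : N, (x : ι →₀ R) ∈ Finsupp.supported R R (Set.Iic i) →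
        (x : ι →₀ R) i = 0 → x ∈ Submodule.span R (Set.range b) := by
      intro x hx hxi
      by_cases hx0 : x = 0
      · simp [hx0]
      obtain ⟨m, hm, hmax⟩ := (x : ι →₀ R).support.exists_max_image id
        (Finsupp.support_nonempty_iff.2 (by simpa using hx0))
      refine ih m (lt_of_le_of_ne ((Finsupp.mem_supported R _).1 hx hm) ?_) x
        ((Finsupp.mem_supported R _).2 hmax)
      rintro rfl
      exact Finsupp.mem_support_iff.1 hm hxi
    intro x hx
    have hxJ : (x : ι →₀ R) i ∈ J i := ⟨x, ⟨x.2, hx⟩, rfl⟩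
    obtain ⟨c, hc⟩ := (Submodule.IsPrincipal.mem_iff_eq_smul_generator (J i)).1 hxJ
    by_cases hai : a i = 0
    · exact lower x hx (by rw [hc]; change c • a i = 0; simp [hai])
    · have := lower (x - c • b ⟨i, hai⟩)
        (Submodule.sub_mem _ hx (Submodule.smul_mem _ _ (hgN i).2))
        (by simp only [b, Submodule.coe_sub, Submodule.coe_smul, Finsupp.sub_apply,
              Finsupp.smul_apply, hga, hc]; exact sub_self _)
      rw [← sub_add_cancel x (c • b ⟨i, hai⟩)]
      exact add_mem this (Submodule.smul_mem _ _ (Submodule.subset_span ⟨_, rfl⟩))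
  refine Module.Free.of_basis (Module.Basis.mk hli fun x _ ↦ ?_)
  by_cases hx0 : x = 0
  · simp [hx0]
  obtain ⟨m, hm, hmax⟩ := (x : ι →₀ R).support.exists_max_image id
    (Finsupp.support_nonempty_iff.2 (by simpa using hx0))
  exact hspan m x ((Finsupp.mem_supported R _).2 hmax)

theorem Submodule.free_of_isPrincipalIdealRing {R M : Type*} [CommRing R] [IsDomain R]
    [IsPrincipalIdealRing R] [AddCommGroup M] [Module R M] [Module.Free R M]
    (N : Submodule R M) : Module.Free R N :=
  have := Submodule.free_of_finsupp (N.map (Module.Free.chooseBasis R M).repr.toLinearMap)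
  Module.Free.of_equiv ((Module.Free.chooseBasis R M).repr.submoduleMap N).symm

/-- An abelian group is finite-by-free if it maps to a free abelian group with finite kernel. -/
def IsFiniteByFree (A : Type u) [AddCommGroup A] : Prop :=
  ∃ (M : Type u) (_ : AddCommGroup M) (_ : Module.Free ℤ M) (φ : A →ₗ[ℤ] M),
    Finite (LinearMap.ker φ)

namespace IsFiniteByFree

variable {A B M : Type u} [AddCommGroup A] [AddCommGroup B] [AddCommGroup M]

theorem of_injective (hB : IsFiniteByFree B) (f : A →ₗ[ℤ] B) (hf : Function.Injective f) :
    IsFiniteByFree A := by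
  obtain ⟨M, _, hM, φ, hφ⟩ := hB
  refine ⟨M, inferInstance, hM, φ ∘ₗ f, ?_⟩
  exact Finite.of_injective (fun x ↦ (⟨f x, x.2⟩ : LinearMap.ker φ))
    fun x y h ↦ Subtype.ext (hf (congrArg Subtype.val h))

theorem of_ker [Module.Free ℤ M] (ψ : A →ₗ[ℤ] M) (h : IsFiniteByFree (LinearMap.ker ψ)) :
    IsFiniteByFree A := by
  obtain ⟨P, _, hP, φ, hφ⟩ := h
  have : Module.Free ℤ (LinearMap.range ψ) := Submodule.free_of_isPrincipalIdealRing _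
  obtain ⟨s, hs⟩ := Module.projective_lifting_property ψ.rangeRestrict LinearMap.id
    ψ.surjective_rangeRestrict
  have hs' : ∀ y, ψ (s y) = y := fun y ↦ congrArg Subtype.val (LinearMap.congr_fun hs y)
  let r : A →ₗ[ℤ] LinearMap.ker ψ :=
    (LinearMap.id - s ∘ₗ ψ.rangeRestrict).codRestrict _ fun a ↦ by simp [hs']
  have hr : ∀ a, ψ a = 0 → (r a : A) = a := fun a ha ↦ by
    have : ψ.rangeRestrict a = 0 := Subtype.ext ha
    simp [r, this]
  refine ⟨P × M, inferInstance, inferInstance, (φ ∘ₗ r).prod ψ, ?_⟩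
  have hx : ∀ x : LinearMap.ker ((φ ∘ₗ r).prod ψ), φ (r x) = 0 ∧ ψ x = 0 := fun x ↦ by
    simpa using x.2
  refine Finite.of_injective (fun x ↦ (⟨r x, (hx x).1⟩ : LinearMap.ker φ)) fun x y h ↦ ?_
  have := congrArg (fun z ↦ ((z : LinearMap.ker ψ) : A)) (congrArg Subtype.val h)
  simpa [hr _ (hx x).2, hr _ (hx y).2] using this

theorem exists_isCompl (h : IsFiniteByFree A) :
    ∃ T N : Submodule ℤ A, Finite T ∧ Module.Free ℤ N ∧ T ⊓ N = ⊥ ∧ T ⊔ N = ⊤ := by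
  obtain ⟨M, _, hM, φ, hφ⟩ := h
  have : Module.Free ℤ (LinearMap.range φ) := Submodule.free_of_isPrincipalIdealRing _
  obtain ⟨s, hs⟩ := Module.projective_lifting_property φ.rangeRestrict LinearMap.id
    φ.surjective_rangeRestrict
  have hinj : Function.Injective s := fun x y h ↦ by
    simpa using (LinearMap.congr_fun hs x).symm.trans
      ((congrArg φ.rangeRestrict h).trans (LinearMap.congr_fun hs y))
  have hs' : ∀ y, φ (s y) = y := fun y ↦ congrArg Subtype.val (LinearMap.congr_fun hs y)
  refine ⟨LinearMap.ker φ, LinearMap.range s, hφ,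
    Module.Free.of_equiv (LinearEquiv.ofInjective s hinj), ?_, ?_⟩
  · rw [eq_bot_iff]
    rintro _ ⟨hx, y, rfl⟩
    have : y = 0 := Subtype.ext ((hs' y).symm.trans hx)
    simp [this]
  · rw [eq_top_iff]
    intro x _
    rw [← sub_add_cancel x (s (φ.rangeRestrict x))]
    exact Submodule.add_mem_sup (by simp [hs']) ⟨_, rfl⟩

theorem finite_torsion (h : IsFiniteByFree A) : {a : A | IsOfFinAddOrder a}.Finite := by
  obtain ⟨M, _, hM, φ, hφ⟩ := h
  refine (Set.toFinite (LinearMap.ker φ : Set A)).subset fun a ha ↦ ?_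
  obtain ⟨n, hn, hna⟩ := isOfFinAddOrder_iff_nsmul_eq_zero.1 ha
  have : n • φ a = 0 := by rw [← map_nsmul, hna, map_zero]
  have hz : (n : ℤ) • φ a = 0 := by simpa using this
  have : Module.IsTorsionFree ℤ M := inferInstance
  exact (smul_eq_zero.1 hz).resolve_left (by exact_mod_cast hn.ne')

end IsFiniteByFree

open Polynomial IntermediateField algebraAdjoinAdjoin IsDedekindDomain
open scoped NumberField

theorem IsDedekindDomain.exists_divisor_linearMap (B L : Type*) [CommRing B] [IsDedekindDomain B]
    [Field L] [Algebra B L] [IsFractionRing B L] :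
    ∃ ψ : Additive Lˣ →ₗ[ℤ] (HeightOneSpectrum B →₀ ℤ),
      ∀ x : Lˣ, ψ (.ofMul x) = 0 → (x : L) ∈ (algebraMap B L).range := by
  have hfin : ∀ x : Lˣ, {v : HeightOneSpectrum B |
      (v.valuationOfNeZero x : Multiplicative ℤ).toAdd ≠ 0}.Finite := fun x ↦ by
    refine ((HeightOneSpectrum.Support.finite B (x : L)).union
      (HeightOneSpectrum.Support.finite B ((x⁻¹ : Lˣ) : L))).subset fun v hv ↦ ?_
    change 1 < v.valuation L (x : L) ∨ 1 < v.valuation L ((x⁻¹ : Lˣ) : L)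
    rw [← v.valuationOfNeZero_eq, ← v.valuationOfNeZero_eq, map_inv]
    have h1 : v.valuationOfNeZero x ≠ 1 := hv
    rcases lt_or_gt_of_ne h1 with h | h
    · right
      exact_mod_cast one_lt_inv_of_inv h
    · left
      exact_mod_cast h
  refine ⟨AddMonoidHom.toIntLinearMap
    { toFun x := Finsupp.ofSupportFinite
        (fun v ↦ (v.valuationOfNeZero x.toMul : Multiplicative ℤ).toAdd) (hfin x.toMul)
      map_zero' := by ext v; simp [Finsupp.ofSupportFinite_coe]
      map_add' x y := by ext v; exact congrArg Multiplicative.toAdd (map_mul v.valuationOfNeZero x.toMul y.toMul) }, fun x hx ↦ ?_⟩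
  refine HeightOneSpectrum.mem_integers_of_valuation_le_one L _ fun v ↦ ?_
  have h : v.valuationOfNeZero x = 1 := DFunLike.congr_fun hx v
  rw [← v.valuationOfNeZero_eq, h]
  exact le_rfl

theorem NumberField.isFiniteByFree_units (L : Type u) [Field L] [NumberField L] :
    IsFiniteByFree (Additive Lˣ) := by
  obtain ⟨ψ, hψ⟩ := IsDedekindDomain.exists_divisor_linearMap (𝓞 L) L
  have hU : IsFiniteByFree (Additive (𝓞 L)ˣ) := by
    refine ⟨Additive ((𝓞 L)ˣ ⧸ Units.torsion L), inferInstance, inferInstance,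
      (QuotientGroup.mk' (Units.torsion L)).toAdditive.toIntLinearMap, ?_⟩
    refine Finite.of_injective (β := Units.torsion L)
      (fun x ↦ ⟨x.1.toMul, (QuotientGroup.eq_one_iff _).1 x.2⟩) fun x y h ↦ ?_
    exact Subtype.ext (congrArg (fun z : Units.torsion L ↦ Additive.ofMul (z : (𝓞 L)ˣ)) h)
  have hmem : ∀ x : LinearMap.ker ψ, ∃ y : (𝓞 L)ˣ,
      Units.map (algebraMap (𝓞 L) L : 𝓞 L →* L) y = x.1.toMul := fun x ↦ by
    obtain ⟨y, hy⟩ := hψ x.1.toMul x.2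
    obtain ⟨z, hz⟩ := hψ (x.1.toMul)⁻¹ (-x).2
    have hyz : y * z = 1 := FaithfulSMul.algebraMap_injective (𝓞 L) L (by simp [hy, hz])
    exact ⟨⟨y, z, hyz, mul_comm y z ▸ hyz⟩, Units.ext hy⟩
  choose f hf using hmem
  have hinj : Function.Injective (Units.map (algebraMap (𝓞 L) L : 𝓞 L →* L)) :=
    Units.map_injective (FaithfulSMul.algebraMap_injective (𝓞 L) L)
  refine .of_ker ψ (hU.of_injective (AddMonoidHom.toIntLinearMap
    { toFun x := .ofMul (f x)
      map_zero' := hinj ((hf 0).trans (map_one _).symm)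
      map_add' x y := hinj ((hf (x + y)).trans
        ((map_mul _ (f x) (f y)).trans (congrArg₂ (· * ·) (hf x) (hf y))).symm) }) fun x y h ↦ ?_)
  refine Subtype.ext ?_
  have : f x = f y := h
  exact Additive.toMul.injective ((hf x).symm.trans ((congrArg _ this).trans (hf y)))

section Transcendental

variable {K L : Type*} [Field K] [Field L] [Algebra K L] {t : L}

instance isPrincipalIdealRing_adjoin_singleton :
    IsPrincipalIdealRing (Algebra.adjoin K {t}) := by
  have h : Function.Surjective (aeval (R := K) t).rangeRestrict :=
    AlgHom.rangeRestrict_surjective _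
  have := IsPrincipalIdealRing.of_surjective _ h
  rwa [Algebra.adjoin_singleton_eq_range_aeval]

theorem Transcendental.mem_range_of_mem_adjoin_of_mem_adjoin_inv (ht : Transcendental K t) {y : L}
    (hy : y ∈ Algebra.adjoin K {t}) (hy' : y ∈ Algebra.adjoin K {t⁻¹}) :
    y ∈ (algebraMap K L).range := by
  rw [Algebra.adjoin_singleton_eq_range_aeval] at hy hy'
  obtain ⟨f, rfl⟩ := hy
  obtain ⟨g, hg⟩ := hy'
  have ht0 : t ≠ 0 := by
    rintro rfl
    exact ht isAlgebraic_zero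
  let : Invertible t⁻¹ := invertibleOfNonzero (inv_ne_zero ht0)
  have h := eval₂_reverse_mul_pow (algebraMap K L) t⁻¹ g
  have h1 : Polynomial.aeval t g.reverse = Polynomial.aeval t (f * X ^ g.natDegree) := by
    simp only [invOf_eq_inv, inv_inv] at h
    have hg' : eval₂ (algebraMap K L) t⁻¹ g = Polynomial.aeval t f := hg
    rw [map_mul, map_pow, aeval_X, ← hg', ← h, mul_assoc, ← mul_pow, inv_mul_cancel₀ ht0,
      one_pow, mul_one, aeval_def]
  have h2 : g.reverse = f * X ^ g.natDegree :=
    transcendental_iff_injective.1 ht h1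
  by_cases hf : f = 0
  · simp [hf]
  have h3 := reverse_natDegree_le g
  rw [h2, natDegree_mul_X_pow _ hf] at h3
  rw [eq_C_of_natDegree_eq_zero (p := f) (by omega)]
  simp

theorem IntermediateField.coeff_minpoly_mem_adjoin {M : IntermediateField K L} (hM : M = K⟮t⟯)
    {x : L} (hx : IsIntegral (Algebra.adjoin K {t}) x) (i : ℕ) :
    ((minpoly M x).coeff i : L) ∈ Algebra.adjoin K {t} := by
  subst hM
  rw [minpoly.isIntegrallyClosed_eq_field_fractions' K⟮t⟯ hx, coeff_map]
  exact ((minpoly (Algebra.adjoin K {t}) x).coeff i).2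

theorem Transcendental.isAlgebraic_of_isIntegral_adjoin (ht : Transcendental K t) {x : L}
    (hx : IsIntegral (Algebra.adjoin K {t}) x) (hx' : IsIntegral (Algebra.adjoin K {t⁻¹}) x) :
    IsAlgebraic K x := by
  have hM : K⟮t⟯ = K⟮t⁻¹⟯ := by
    apply le_antisymm <;> rw [adjoin_simple_le_iff]
    · simpa using inv_mem (mem_adjoin_simple_self K t⁻¹)
    · exact inv_mem (mem_adjoin_simple_self K t)
  have hl : minpoly K⟮t⟯ x ∈ lifts (algebraMap K K⟮t⟯) := by
    rw [lifts_iff_coeff_lifts]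
    intro i
    obtain ⟨c, hc⟩ := ht.mem_range_of_mem_adjoin_of_mem_adjoin_inv
      (coeff_minpoly_mem_adjoin rfl hx i) (coeff_minpoly_mem_adjoin hM hx' i)
    exact ⟨c, Subtype.ext hc⟩
  obtain ⟨p, hp⟩ := (mem_lifts _).1 hl
  have hxM : IsIntegral K⟮t⟯ x := hx.tower_top
  refine ⟨p, ?_, ?_⟩
  · rintro rfl
    exact minpoly.ne_zero hxM (by simpa using hp.symm)
  · rw [← aeval_map_algebraMap K⟮t⟯, hp, minpoly.aeval]

theorem Transcendental.finiteDimensional_algebraicClosure (ht : Transcendental K t)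
    [FiniteDimensional K⟮t⟯ L] : FiniteDimensional K (algebraicClosure K L) := by
  let F := algebraicClosure K L
  let b := Module.Basis.ofVectorSpace K F
  have htF : Transcendental F t := ht.extendScalars F
  have hb : LinearIndependent (Algebra.adjoin K {t}) fun i ↦ (b i : L) := by
    rw [linearIndependent_iff']
    intro s g hg i hi
    have hp : ∀ i, ∃ p : K[X], Polynomial.aeval t p = (g i : L) := fun i ↦
      Algebra.adjoin_mem_exists_aeval K t (g i).2
    choose p hp using hp
    have h0 : ∑ i ∈ s, C (b i) * (p i).map (algebraMap K F) = 0 := by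
      refine transcendental_iff.1 htF _ ?_
      rw [map_sum, ← hg]
      refine Finset.sum_congr rfl fun j _ ↦ ?_
      rw [map_mul, aeval_C, aeval_map_algebraMap, hp, Algebra.smul_def, mul_comm]
      rfl
    have hpi : p i = 0 := by
      ext n
      have hn := congrArg (coeff · n) h0
      simp only [finsetSum_coeff, coeff_C_mul, coeff_map, coeff_zero] at hn
      refine linearIndependent_iff'.1 b.linearIndependent s (fun j ↦ (p j).coeff n) ?_ i hi
      simpa [Algebra.smul_def, mul_comm] using hn
    exact Subtype.ext (by rw [← hp, hpi]; simp)
  have hb' := (LinearIndependent.iff_fractionRing _ K⟮t⟯).1 hb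
  have := hb'.finite
  exact Module.Finite.of_basis b

end Transcendental

/-- The unit groups of all finite extensions of `K` are finite-by-free. -/
def HasFiniteByFreeUnits (K : Type u) [Field K] : Prop :=
  ∀ (L : Type u) [Field L] [Algebra K L] [FiniteDimensional K L], IsFiniteByFree (Additive Lˣ)

theorem exists_divisor_adjoin_simple {K L : Type*} [Field K] [CharZero K] [Field L] [Algebra K L]
    (t : L) [FiniteDimensional K⟮t⟯ L] :
    ∃ ψ : Additive Lˣ →ₗ[ℤ]
        (HeightOneSpectrum (integralClosure (Algebra.adjoin K {t}) L) →₀ ℤ),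
      ∀ x : Lˣ, ψ (.ofMul x) = 0 → IsIntegral (Algebra.adjoin K {t}) (x : L) := by
  have := integralClosure.isDedekindDomain (Algebra.adjoin K {t}) K⟮t⟯ L
  have := IsIntegralClosure.isFractionRing_of_finite_extension (Algebra.adjoin K {t}) K⟮t⟯ L
    (integralClosure (Algebra.adjoin K {t}) L)
  obtain ⟨ψ, hψ⟩ := IsDedekindDomain.exists_divisor_linearMap
    (integralClosure (Algebra.adjoin K {t}) L) L
  refine ⟨ψ, fun x hx ↦ ?_⟩
  obtain ⟨y, hy⟩ := hψ x hx
  exact hy ▸ y.2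

theorem HasFiniteByFreeUnits.isFiniteByFree_of_transcendental {K L : Type u} [Field K] [CharZero K]
    [Field L] [Algebra K L] (hK : HasFiniteByFreeUnits K) {t : L} (ht : Transcendental K t)
    [FiniteDimensional K⟮t⟯ L] : IsFiniteByFree (Additive Lˣ) := by
  have hM : K⟮t⁻¹⟯ = K⟮t⟯ := by
    apply le_antisymm <;> rw [adjoin_simple_le_iff]
    · exact inv_mem (mem_adjoin_simple_self K t)
    · simpa using inv_mem (mem_adjoin_simple_self K t⁻¹)
  have : FiniteDimensional K⟮t⁻¹⟯ L := by rw [hM]; infer_instance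
  have := ht.finiteDimensional_algebraicClosure
  obtain ⟨ψ, hψ⟩ := exists_divisor_adjoin_simple (K := K) t
  obtain ⟨ψ', hψ'⟩ := exists_divisor_adjoin_simple (K := K) t⁻¹
  have hmem : ∀ x : LinearMap.ker (ψ.prod ψ'), (x.1.toMul : L) ∈ algebraicClosure K L := fun x ↦ by
    have hx : ψ x.1 = 0 ∧ ψ' x.1 = 0 := by simpa using x.2
    exact mem_algebraicClosure_iff.2
      (ht.isAlgebraic_of_isIntegral_adjoin (hψ _ hx.1) (hψ' _ hx.2))
  refine .of_ker (ψ.prod ψ') ((hK (algebraicClosure K L)).of_injective (AddMonoidHom.toIntLinearMap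
    { toFun x := .ofMul (Units.mk0 ⟨x.1.toMul, hmem x⟩
        fun h ↦ x.1.toMul.ne_zero (congrArg Subtype.val h))
      map_zero' := Units.ext (Subtype.ext rfl)
      map_add' x y := Units.ext (Subtype.ext rfl) }) fun x y h ↦ ?_)
  exact Subtype.ext (Units.ext (congrArg (fun z : Additive (algebraicClosure K L)ˣ ↦
    ((z.toMul : algebraicClosure K L) : L)) h))

theorem HasFiniteByFreeUnits.adjoin_simple {K E : Type u} [Field K] [CharZero K]
    [Field E] [Algebra K E] (hK : HasFiniteByFreeUnits K) (s : E) :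
    HasFiniteByFreeUnits K⟮s⟯ := by
  intro L _ _ _
  let : Algebra K L := ((algebraMap K⟮s⟯ L).comp (algebraMap K K⟮s⟯)).toAlgebra
  have : IsScalarTower K K⟮s⟯ L := .of_algebraMap_eq' rfl
  by_cases hs : IsAlgebraic K s
  · have := adjoin.finiteDimensional hs.isIntegral
    have : FiniteDimensional K L := .trans K K⟮s⟯ L
    exact hK L
  · let φ : K⟮s⟯ →ₐ[K] L := IsScalarTower.toAlgHom K K⟮s⟯ L
    let t : L := φ (AdjoinSimple.gen K s)
    have ht : Transcendental K t := by
      intro h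
      rw [isAlgebraic_algHom_iff φ φ.injective] at h
      have := h.algHom K⟮s⟯.val
      exact hs (by simpa using this)
    have hrange : ∀ y, φ y ∈ K⟮t⟯ := fun y ↦ by
      have hle : K⟮s⟯ ≤ lift (K⟮t⟯.comap φ) :=
        adjoin_simple_le_iff.2 ⟨AdjoinSimple.gen K s, mem_adjoin_simple_self K t, rfl⟩
      obtain ⟨z, hz, hzy⟩ := hle y.2
      rwa [← Subtype.ext hzy]
    let : Algebra K⟮s⟯ K⟮t⟯ := ((φ : K⟮s⟯ →+* L).codRestrict K⟮t⟯ hrange).toAlgebra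
    have : IsScalarTower K⟮s⟯ K⟮t⟯ L := .of_algebraMap_eq' rfl
    have : FiniteDimensional K⟮t⟯ L := .right K⟮s⟯ K⟮t⟯ L
    exact hK.isFiniteByFree_of_transcendental ht

theorem isFiniteByFree_units_of_adjoin_eq_top {F : Type u} [Field F] [CharZero F] {S : Set F}
    (hS : S.Finite) (hgen : IntermediateField.adjoin ℚ S = ⊤) : IsFiniteByFree (Additive Fˣ) := by
  have h : HasFiniteByFreeUnits (IntermediateField.adjoin ℚ S) := by
    refine induction_on_adjoin_fg (fun K ↦ HasFiniteByFreeUnits K) ?_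
      (fun K x hK ↦ hK.adjoin_simple x) _ (fg_adjoin_of_finite hS)
    intro L _ _ _
    have : CharZero L := charZero_of_injective_algebraMap
      (algebraMap (⊥ : IntermediateField ℚ F) L).injective
    have : FiniteDimensional ℚ L := .trans ℚ (⊥ : IntermediateField ℚ F) L
    have : NumberField L := ⟨⟩
    exact NumberField.isFiniteByFree_units L
  rw [hgen] at h
  have : FiniteDimensional (⊤ : IntermediateField ℚ F) F :=
    .of_surjective (Algebra.linearMap _ F) fun x ↦ ⟨⟨x, trivial⟩, rfl⟩
  exact h F

/-- Proposition 2.3(i): a finitely generated field of characteristic zero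
has finite `π(t(f*))`, is regular, and `f* = T × F` with `T` finite and `F` free abelian. -/
theorem units_of_finitely_generated_charZero_field
    (F : Type*) [Field F] [CharZero F]
    (S : Set F) (hS : S.Finite) (hgen : IntermediateField.adjoin ℚ S = ⊤) :
    {p : ℕ | p.Prime ∧ ∃ x : Fˣ, orderOf x = p}.Finite ∧
    IsRegularField F ∧
    ∃ T Fr : Subgroup Fˣ, Finite T ∧ Module.Free ℤ (Additive Fr) ∧
      T ⊓ Fr = ⊥ ∧ T ⊔ Fr = ⊤ := by
  have h := isFiniteByFree_units_of_adjoin_eq_top hS hgen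
  have hcount : Countable F := by
    have : Countable (IntermediateField.adjoin ℚ S) := by
      have := hS.countable.to_subtype
      rw [← Cardinal.mk_le_aleph0_iff]
      refine (Cardinal.lift_le_aleph0.1 <| (lift_cardinalMk_adjoin_le ℚ S).trans ?_)
      simp
    rw [hgen] at this
    exact (topEquiv (F := ℚ) (E := F)).symm.toEquiv.injective.countable
  have hsplit : ∃ T Fr : Subgroup Fˣ, Finite T ∧ Module.Free ℤ (Additive Fr) ∧
      T ⊓ Fr = ⊥ ∧ T ⊔ Fr = ⊤ := by
    obtain ⟨T, N, hT, hN, hinf, hsup⟩ := h.exists_isCompl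
    refine ⟨T.toAddSubgroup.toSubgroup', N.toAddSubgroup.toSubgroup', hT, hN, ?_, ?_⟩
    · ext x
      exact SetLike.ext_iff.1 hinf (Additive.ofMul x)
    · rw [eq_top_iff]
      intro x _
      obtain ⟨y, hy, z, hz, hyz⟩ := Submodule.mem_sup.1 (hsup ▸ Submodule.mem_top :
        Additive.ofMul x ∈ T ⊔ N)
      exact Subgroup.mem_sup.2 ⟨y.toMul, hy, z.toMul, hz, hyz⟩
  refine ⟨?_, ⟨hcount, ?_⟩, hsplit⟩
  · refine (h.finite_torsion.image addOrderOf).subset ?_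
    rintro p ⟨hp, x, rfl⟩
    exact ⟨.ofMul x, isOfFinAddOrder_ofMul_iff.2 (orderOf_pos_iff.1 hp.pos),
      addOrderOf_ofMul_eq_orderOf x⟩
  · obtain ⟨T, Fr, hT, hFr, hinf, hsup⟩ := hsplit
    exact ⟨T, Fr, fun x hx ↦ Submonoid.isOfFinOrder_coe.2
      (isOfFinOrder_of_finite (⟨x, hx⟩ : T)), hFr, hinf, hsup⟩
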